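/- With c_n as above (recurrence 4(n+4)c_{n+5}+8(n+2)c_{n+4}+(n+3)c_{n+3}+(4n+7)c_{n+2}+(5n+4)c_{n+1}+2n c_n=0, c_0=0, c_1=1, c_2=2, c_3=-1/8, c_4=-1/2), for every odd prime p and all k, r ∈ ℕ, the congruence c_{k·p^{r+1}} ≡ c_{k·p^r} (mod p^{r+1}) holds in ℤ_p. -/

import Mathlib

open PowerSeries in
/-- The Gauss congruences at `p` for the coefficients of a power series. -/
def PowerSeries.GaussCongruent {R : Type*} [CommRing R] (p : ℕ) (S : R⟦X⟧) : Prop :=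
  ∀ k r : ℕ, (p : R) ^ (r + 1) ∣ coeff (k * p ^ (r + 1)) S - coeff (k * p ^ r) S

namespace PowerSeries

variable {R : Type*} [CommRing R] {p : ℕ}

theorem GaussCongruent.add {S T : R⟦X⟧} (hS : GaussCongruent p S) (hT : GaussCongruent p T) :
    GaussCongruent p (S + T) := by
  intro k r
  have := dvd_add (hS k r) (hT k r)
  simp only [map_add]
  convert this using 1
  ring

theorem mul_natCast_pow_dvd_mul_pow_sub_pow (hp : p.Prime) (hR : ∀ a : R, (p : R) ∣ a ^ p - a)
    {n t r : ℕ} (h : p ^ r ∣ n * t) (a : R) :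
    (p : R) ^ (r + 1) ∣ (n : R) * (a ^ (t * p) - a ^ t) := by
  obtain ⟨y, z, hy, hz, hyz⟩ := (Nat.dvd_mul).1 h
  obtain ⟨i, -, rfl⟩ := (Nat.dvd_prime_pow hp).1 (Dvd.intro _ hyz)
  obtain ⟨j, -, rfl⟩ := (Nat.dvd_prime_pow hp).1 (Dvd.intro_left _ hyz)
  have hij : i + j = r := Nat.pow_right_injective hp.two_le (by simpa [pow_add] using hyz)
  obtain ⟨t', rfl⟩ := hz
  have h1 := dvd_sub_pow_of_dvd_sub (hR (a ^ t')) j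
  have h2 : (p : R) ^ i ∣ (n : R) := mod_cast Nat.cast_dvd_cast (α := R) hy
  rw [← hij, add_assoc, pow_add]
  refine mul_dvd_mul h2 ?_
  convert h1 using 2
  · rw [← pow_mul, ← pow_mul]; congr 1; ring
  · rw [← pow_mul]; congr 1; ring

/-- The logarithmic derivative `X * f' / f` of `f = 1 - a * X ^ n`. -/
noncomputable def logDerivOneSub (a : R) (n : ℕ) : R⟦X⟧ :=
  mk fun m => if n ∣ m ∧ m ≠ 0 then -((n : R) * a ^ (m / n)) else 0

theorem X_mul_derivative_one_sub (a : R) {n : ℕ} (hn : 0 < n) :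
    X * d⁄dX R (1 - C a * X ^ n) = (1 - C a * X ^ n) * logDerivOneSub a n := by
  have h : X * d⁄dX R (1 - C a * X ^ n) = C (-(n * a)) * X ^ n := by
    obtain ⟨n, rfl⟩ := Nat.exists_eq_succ_of_ne_zero hn.ne'
    simp [Derivation.leibniz]
    ring
  rw [h, sub_mul, one_mul, mul_assoc, mul_comm (X ^ n)]
  ext m
  simp only [map_sub, coeff_C_mul, coeff_mul_X_pow', logDerivOneSub, coeff_mk, coeff_C]
  rcases lt_trichotomy m n with hm | rfl | hm
  · have : ¬ (n ∣ m ∧ m ≠ 0) := fun ⟨h, h0⟩ => by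
      have := Nat.le_of_dvd (Nat.pos_of_ne_zero h0) h
      omega
    simp [this, hm.not_ge]
  · simp [hn.ne', Nat.div_self hn]
  · obtain ⟨t, rfl⟩ := Nat.exists_eq_add_of_lt hm
    have h1 : n ∣ n + t + 1 ↔ n ∣ t + 1 := by rw [add_assoc]; simp
    have h2 : n + t + 1 - n = t + 1 := by omega
    have h3 : (n + t + 1) / n = (t + 1) / n + 1 := by
      rw [add_assoc, Nat.add_div_left _ hn]
    simp only [h1, h2, h3]
    by_cases h : n ∣ t + 1
    · simp [h, add_assoc, pow_succ]; ring
    · simp [h, add_assoc]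

theorem gaussCongruent_logDerivOneSub (hp : p.Prime) (hR : ∀ a : R, (p : R) ∣ a ^ p - a)
    (a : R) {n : ℕ} (hn : 0 < n) : GaussCongruent p (logDerivOneSub a n) := by
  intro k r
  rcases Nat.eq_zero_or_pos k with rfl | hk
  · simp
  have h0 : k * p ^ r ≠ 0 := by have := hp.pos; positivity
  have h1 : k * p ^ (r + 1) ≠ 0 := by have := hp.pos; positivity
  simp only [logDerivOneSub, coeff_mk, h0, h1, ne_eq, not_false_eq_true, and_true]
  by_cases h : n ∣ k * p ^ r
  · obtain ⟨t, ht⟩ := h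
    have ht' : k * p ^ (r + 1) = n * (t * p) := by rw [pow_succ, ← mul_assoc, ht, mul_assoc]
    rw [ht, ht', if_pos ⟨_, rfl⟩, if_pos ⟨_, rfl⟩, Nat.mul_div_cancel_left _ hn,
      Nat.mul_div_cancel_left _ hn]
    have := mul_natCast_pow_dvd_mul_pow_sub_pow hp hR (ht ▸ Dvd.intro_left k rfl) a
    rw [← dvd_neg] at this
    convert this using 1
    ring
  · rw [if_neg h, sub_zero]
    split_ifs with h'
    · obtain ⟨t, ht⟩ := h'
      have hpt : ¬ p ∣ t := by
        rintro ⟨t', rfl⟩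
        refine h ⟨t', Nat.eq_of_mul_eq_mul_right hp.pos ?_⟩
        rw [mul_assoc, ← pow_succ, ht]; ring
      have hdvd : p ^ (r + 1) ∣ n :=
        ((hp.coprime_iff_not_dvd.2 hpt).pow_left (r + 1)).dvd_of_dvd_mul_right
          (ht ▸ Dvd.intro_left k rfl)
      rw [dvd_neg]
      exact Dvd.dvd.mul_right (mod_cast Nat.cast_dvd_cast (α := R) hdvd) _
    · exact dvd_zero _

theorem exists_gaussCongruent_approx (hp : p.Prime) (hR : ∀ a : R, (p : R) ∣ a ^ p - a)
    {w : R⟦X⟧} (hw : constantCoeff w = 1) (N : ℕ) :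
    ∃ P S : R⟦X⟧, constantCoeff P = 1 ∧ X * d⁄dX R P = P * S ∧ GaussCongruent p S ∧
      X ^ (N + 1) ∣ w - P := by
  induction N with
  | zero =>
    refine ⟨1, 0, by simp, by simp, fun k r => by simp, ?_⟩
    rw [zero_add, pow_one, X_dvd_iff]
    simp [hw]
  | succ N ih =>
    obtain ⟨P, S, hP, hPS, hS, q, hq⟩ := ih
    refine ⟨P * (1 - C (-constantCoeff q) * X ^ (N + 1)),
      S + logDerivOneSub (-constantCoeff q) (N + 1), by simp [hP], ?_,
      hS.add (gaussCongruent_logDerivOneSub hp hR _ N.succ_pos), ?_⟩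
    · have := X_mul_derivative_one_sub (-constantCoeff q) (n := N + 1) N.succ_pos
      rw [Derivation.leibniz, smul_eq_mul, smul_eq_mul]
      linear_combination P * this + (1 - C (-constantCoeff q) * X ^ (N + 1)) * hPS
    · have h : X ∣ q - C (constantCoeff q) * P := by
        rw [X_dvd_iff]; simp [hP]
      have := mul_dvd_mul_left (X ^ (N + 1)) h
      rw [← pow_succ] at this
      convert this using 1
      rw [map_neg]
      linear_combination hq

theorem gaussCongruent_of_X_mul_derivative_eq (hp : p.Prime)
    (hR : ∀ a : R, (p : R) ∣ a ^ p - a) {w S : R⟦X⟧} (hw : constantCoeff w = 1)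
    (h : X * d⁄dX R w = w * S) : GaussCongruent p S := by
  have key (N : ℕ) : ∃ T : R⟦X⟧, GaussCongruent p T ∧ ∀ m ≤ N, coeff m S = coeff m T := by
    obtain ⟨P, T, -, hPT, hT, q, hq⟩ := exists_gaussCongruent_approx hp hR hw N
    refine ⟨T, hT, fun m hm => ?_⟩
    have hd : X ^ (N + 1) ∣ w * (S - T) := by
      refine ⟨((N + 1 : ℕ) : R⟦X⟧) * q + X * d⁄dX R q - q * T, ?_⟩
      have h1 := congrArg (fun f => X * d⁄dX R f) hq
      simp only [map_sub, Derivation.leibniz, derivative_pow, derivative_X, smul_eq_mul,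
        Nat.add_sub_cancel] at h1
      linear_combination h1 - h + hPT - T * hq
    have hu : IsUnit w := isUnit_iff_constantCoeff.2 (by simp [hw])
    have := X_pow_dvd_iff.1 ((hu.dvd_mul_left).1 hd) m (by omega)
    rwa [map_sub, sub_eq_zero] at this
  intro k r
  obtain ⟨T, hT, hST⟩ := key (k * p ^ (r + 1))
  rw [hST _ le_rfl, hST _ (Nat.mul_le_mul_left k (Nat.pow_le_pow_right hp.pos r.le_succ))]
  exact hT k r

end PowerSeries

theorem PadicInt.natCast_dvd_pow_sub_self {p : ℕ} [Fact p.Prime] (a : ℤ_[p]) :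
    (p : ℤ_[p]) ∣ a ^ p - a := by
  rw [← Ideal.mem_span_singleton, ← PadicInt.maximalIdeal_eq_span_p, ← PadicInt.ker_toZMod,
    RingHom.mem_ker]
  simp

namespace PowerSeries

/-- Square roots of `1 + t` exist in `ℤ_p⟦X⟧` when `2` is invertible. -/
theorem exists_sq_eq_one_add {p : ℕ} [Fact p.Prime] {h : ℤ_[p]} (hh : 2 * h = 1)
    {t : ℤ_[p]⟦X⟧} (ht : constantCoeff t = 0) :
    ∃ Y : ℤ_[p]⟦X⟧, constantCoeff Y = 1 ∧ Y ^ 2 = 1 + t := by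
  have ht' := HasSubst.of_constantCoeff_zero' ht
  have hsq : (binomialSeries ℤ_[p] h) ^ 2 = 1 + X := by
    rw [sq, ← binomialSeries_add, ← two_mul, hh]
    simpa using binomialSeries_nat (R := ℤ_[p]) (A := ℤ_[p]) 1
  have hY := congrArg (substAlgHom (R := ℤ_[p]) ht') hsq
  rw [map_pow, map_add, map_one, substAlgHom_X] at hY
  have hc := congrArg constantCoeff hY
  rw [map_pow, map_add, map_one, ht, add_zero, sq_eq_one_iff] at hc
  rcases hc with hc | hc
  · exact ⟨_, hc, hY⟩
  · exact ⟨-_, by rw [map_neg, hc, neg_neg], by rw [neg_sq, hY]⟩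

variable {R : Type*} [CommRing R]

theorem gaussCongruent_of_mul_eq {p : ℕ} (hp : p.Prime) (hR : ∀ a : R, (p : R) ∣ a ^ p - a)
    {h : R} (hh : 2 * h = 1) {Y S : R⟦X⟧} (hY0 : constantCoeff Y = 1)
    (hY : Y ^ 2 = 1 + C (h ^ 2) * (X + X ^ 2) ^ 2) (hS : S * Y = X * (1 + 2 * X)) :
    GaussCongruent p S := by
  have hu : IsUnit Y := isUnit_iff_constantCoeff.2 (by simp [hY0])
  have hC : (2 : R⟦X⟧) * C h = 1 := by
    rw [← map_one C, ← hh, map_mul, map_ofNat]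
  have hd : 2 * (Y * d⁄dX R Y) = 2 * (C (h ^ 2) * (X + X ^ 2) * (1 + 2 * X)) := by
    have := congrArg (d⁄dX R) hY
    simp only [map_add, Derivation.leibniz, derivative_pow, derivative_X, derivative_C,
      derivative_one, smul_eq_mul] at this
    push_cast at this
    linear_combination this
  have hG : GaussCongruent p (C h * S) := by
    refine gaussCongruent_of_X_mul_derivative_eq hp hR (w := Y + C h * (X + X ^ 2))
      (by simp [hY0]) (hu.mul_right_cancel ?_)
    simp only [map_add, Derivation.leibniz, derivative_pow, derivative_X, derivative_C,
      smul_eq_mul]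
    rw [map_pow] at hd
    push_cast
    linear_combination C h * X * hd - (Y + C h * (X + X ^ 2)) * C h * hS
      + (-X * Y * d⁄dX R Y + X * C h ^ 2 * (X + X ^ 2) * (1 + 2 * X)) * hC
  have : S = C h * S + C h * S := by linear_combination -S * hC
  rw [this]
  exact hG.add hG

theorem linear_ode_of_mul_eq {h : R} (hh : 2 * h = 1) {Y S : R⟦X⟧}
    (hY : Y ^ 2 = 1 + C (h ^ 2) * (X + X ^ 2) ^ 2) (hS : S * Y = X * (1 + 2 * X)) :
    C 4 * (X * d⁄dX R S) + C 8 * (X * d⁄dX R S) * X ^ 1 + C 1 * (X * d⁄dX R S) * X ^ 2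
      + C 4 * (X * d⁄dX R S) * X ^ 3 + C 5 * (X * d⁄dX R S) * X ^ 4
      + C 2 * (X * d⁄dX R S) * X ^ 5
      = C 4 * S + C 16 * S * X ^ 1 + S * X ^ 3 + S * X ^ 4 := by
  have hC : (4 : R⟦X⟧) * C (h ^ 2) = 1 := by
    rw [← map_ofNat C, ← map_mul, ← map_one C]; congr 1; linear_combination (2 * h + 1) * hh
  have hY4 : 4 * Y ^ 2 = 4 + (X + X ^ 2) ^ 2 := by
    linear_combination 4 * hY + (X + X ^ 2) ^ 2 * hC
  have hd2 : 8 * (Y * d⁄dX R Y) = 2 * ((X + X ^ 2) * (1 + 2 * X)) := by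
    have := congrArg (d⁄dX R) hY4
    rw [← map_ofNat C] at this
    simp only [map_add, Derivation.leibniz, derivative_pow, derivative_X, derivative_C,
      smul_eq_mul] at this
    simp only [map_ofNat] at this
    push_cast at this
    linear_combination this
  have hCh : (2 : R⟦X⟧) * C h = 1 := by
    rw [← map_one C, ← hh, map_mul, map_ofNat]
  have hd : 4 * (Y * d⁄dX R Y) = (X + X ^ 2) * (1 + 2 * X) := by
    linear_combination C h * hd2 +
      ((X + X ^ 2) * (1 + 2 * X) - 4 * (Y * d⁄dX R Y)) * hCh
  have hSd : d⁄dX R S * Y + S * d⁄dX R Y = 1 + 4 * X := by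
    have := congrArg (d⁄dX R) hS
    rw [← map_ofNat C] at this
    simp only [map_add, Derivation.leibniz, derivative_X, derivative_C, derivative_one,
      smul_eq_mul] at this
    simp only [map_ofNat] at this
    linear_combination this
  simp only [map_ofNat, map_one]
  linear_combination 4 * X * (1 + 2 * X) * Y * hSd - 4 * (1 + 4 * X) * Y * hS
    + (S * (1 + 4 * X) - X * (1 + 2 * X) * d⁄dX R S) * hY4 - X * (1 + 2 * X) * S * hd

theorem coeff_X_mul_derivative (S : R⟦X⟧) (n : ℕ) :
    coeff n (X * d⁄dX R S) = n * coeff n S := by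
  cases n with
  | zero => simp
  | succ n => rw [coeff_succ_X_mul, coeff_derivative]; push_cast; ring

end PowerSeries

theorem PadicInt.coe_ofNat {p : ℕ} [Fact p.Prime] (k : ℕ) [k.AtLeastTwo] :
    ((ofNat(k) : ℤ_[p]) : ℚ_[p]) = ofNat(k) :=
  map_ofNat PadicInt.Coe.ringHom k

open PowerSeries in
theorem eq_coeff_of_recurrence {p : ℕ} [Fact p.Prime] {c : ℕ → ℚ} (h0 : c 0 = 0) (h1 : c 1 = 1)
    (h2 : c 2 = 2) (h3 : c 3 = -1/8) (h4 : c 4 = -1/2)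
    (hrec : ∀ n : ℕ,
      4 * ((n : ℚ) + 4) * c (n + 5) + 8 * ((n : ℚ) + 2) * c (n + 4)
        + ((n : ℚ) + 3) * c (n + 3) + (4 * (n : ℚ) + 7) * c (n + 2)
        + (5 * (n : ℚ) + 4) * c (n + 1) + 2 * (n : ℚ) * c n = 0)
    {h : ℤ_[p]} (hh : 2 * h = 1) {Y S : ℤ_[p]⟦X⟧} (hY0 : constantCoeff Y = 1)
    (hY : Y ^ 2 = 1 + C (h ^ 2) * (X + X ^ 2) ^ 2) (hS : S * Y = X * (1 + 2 * X)) (n : ℕ) :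
    ((c n : ℚ) : ℚ_[p]) = (coeff n S : ℤ_[p]) := by
  have ode (m : ℕ) := congrArg (fun f => ((coeff m f : ℤ_[p]) : ℚ_[p]))
    (linear_ode_of_mul_eq hh hY hS)
  simp only [map_add, mul_assoc, coeff_C_mul] at ode
  simp only [← mul_assoc, coeff_mul_X_pow', coeff_X_mul_derivative] at ode
  have s0 : coeff 0 S = 0 := by
    have := congrArg (coeff 0) hS
    simpa [hY0] using this
  have s1 : coeff 1 S = 1 := by
    have := congrArg (coeff (0 + 1)) hS
    rw [coeff_succ_X_mul] at this
    simpa [coeff_mul, Finset.Nat.antidiagonal_succ, s0, hY0] using this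
  have e2 := ode 2
  have e3 := ode 3
  have e4 := ode 4
  norm_num [s0, s1, PadicInt.coe_ofNat] at e2 e3 e4
  have s2 : ((coeff 2 S : ℤ_[p]) : ℚ_[p]) = 2 := by linear_combination e2 / 4
  have s3 : ((coeff 3 S : ℤ_[p]) : ℚ_[p]) = -1 / 8 := by linear_combination e3 / 8
  have s4 : ((coeff 4 S : ℤ_[p]) : ℚ_[p]) = -1 / 2 := by
    linear_combination e4 / 12 - 2 / 3 * s3 - s2 / 6
  induction n using Nat.strong_induction_on with
  | _ n ih =>
  match n with
  | 0 => simp [h0, s0]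
  | 1 => simp [h1, s1]
  | 2 => simp [h2, s2]
  | 3 => simp [h3, s3]
  | 4 => simp [h4, s4]
  | n + 5 =>
    have e := ode (n + 5)
    have hr := congrArg (fun q : ℚ => (q : ℚ_[p])) (hrec n)
    simp only [show 1 ≤ n + 5 by omega, show 2 ≤ n + 5 by omega, show 3 ≤ n + 5 by omega,
      show 4 ≤ n + 5 by omega, show 5 ≤ n + 5 by omega, if_true,
      show n + 5 - 1 = n + 4 by omega, show n + 5 - 2 = n + 3 by omega,
      show n + 5 - 3 = n + 2 by omega, show n + 5 - 4 = n + 1 by omega,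
      show n + 5 - 5 = n by omega] at e
    push_cast at e hr
    simp only [PadicInt.coe_ofNat] at e
    rw [ih n (by omega), ih (n + 1) (by omega), ih (n + 2) (by omega), ih (n + 3) (by omega),
      ih (n + 4) (by omega)] at hr
    have hn : (4 * ((n : ℚ_[p]) + 4)) ≠ 0 := by
      have : ((4 * (n + 4) : ℕ) : ℚ_[p]) ≠ 0 := Nat.cast_ne_zero.2 (by omega)
      exact_mod_cast this
    refine mul_left_cancel₀ hn ?_
    linear_combination hr - e

/-- For the sequence `c_n` defined by the stated recurrence and initial data, and for every
odd prime `p`, each `c_n` is a `p`-adic integer and `c_{k p^{r+1}} ≡ c_{k p^r} (mod p^{r+1})`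
in `ℤ_p`, for all `k, r ∈ ℕ`. -/
theorem stmt_11 (c : ℕ → ℚ) (h0 : c 0 = 0) (h1 : c 1 = 1) (h2 : c 2 = 2)
    (h3 : c 3 = -1/8) (h4 : c 4 = -1/2)
    (hrec : ∀ n : ℕ,
      4 * ((n : ℚ) + 4) * c (n + 5) + 8 * ((n : ℚ) + 2) * c (n + 4)
        + ((n : ℚ) + 3) * c (n + 3) + (4 * (n : ℚ) + 7) * c (n + 2)
        + (5 * (n : ℚ) + 4) * c (n + 1) + 2 * (n : ℚ) * c n = 0)
    (p : ℕ) [Fact p.Prime] (hp : p ≠ 2) :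
    (∀ n : ℕ, ‖((c n : ℚ) : ℚ_[p])‖ ≤ 1) ∧
    ∀ k r : ℕ,
      ‖((c (k * p ^ (r + 1)) : ℚ) : ℚ_[p]) - ((c (k * p ^ r) : ℚ) : ℚ_[p])‖
        ≤ ((p : ℝ)) ^ (-(r + 1 : ℤ)) := by
  have hp' : p.Prime := Fact.out
  obtain ⟨h, hh⟩ : ∃ h : ℤ_[p], 2 * h = 1 := by
    have h2 : IsUnit ((2 : ℕ) : ℤ_[p]) := by
      rw [PadicInt.isUnit_iff, PadicInt.norm_natCast_eq_one_iff]
      exact (Nat.coprime_primes hp' Nat.prime_two).2 hp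
    obtain ⟨h, hh⟩ := h2.exists_right_inv
    exact ⟨h, by exact_mod_cast hh⟩
  obtain ⟨Y, hY0, hY⟩ := PowerSeries.exists_sq_eq_one_add hh
    (t := PowerSeries.C (h ^ 2) * (PowerSeries.X + PowerSeries.X ^ 2) ^ 2) (by simp)
  have hu : IsUnit Y := PowerSeries.isUnit_iff_constantCoeff.2 (by simp [hY0])
  obtain ⟨S, hS⟩ := hu.dvd (a := PowerSeries.X * (1 + 2 * PowerSeries.X))
  have hS := (hS.trans (mul_comm Y S)).symm
  have hc := eq_coeff_of_recurrence h0 h1 h2 h3 h4 hrec hh hY0 hY hS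
  refine ⟨fun n => hc n ▸ PadicInt.norm_le_one _, fun k r => ?_⟩
  have hG := PowerSeries.gaussCongruent_of_mul_eq hp' PadicInt.natCast_dvd_pow_sub_self
    hh hY0 hY hS k r
  rw [← Ideal.mem_span_singleton, ← PadicInt.norm_le_pow_iff_mem_span_pow] at hG
  rw [hc, hc, ← PadicInt.coe_sub, ← PadicInt.norm_def]
  exact_mod_cast hG
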